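/- arXiv:1106.4447 — 3 statements merged into one kernel-verified Lean document; each statement's English description precedes it below -/
import Mathlib

section
/- For all (z, w) ∈ ℂ^n × ℂ the following identity holds: Im G(z,w) + Σ_{j=1}^n |F_{2j−1}(z,w)|² − Σ_{j=1}^n |F_{2j}(z,w)|² = i·([z] + conj([z]))·(w − conj(w) − 2i·Σ_{j=1}^n |z_j|²). In particular, if Im w = Σ_{j=1}^n |z_j|², then Im G(z,w) + Σ_{j=1}^n |F_{2j−1}(z,w)|² − Σ_{j=1}^n |F_{2j}(z,w)|² = 0; that is, the polynomial map H = (F_1, F_2, …, F_{2n−1}, F_{2n}, G) : ℂ^{n+1} → ℂ^{2n+1} maps the hypersurface M = {(z,w) : Im w − Σ_{j=1}^n |z_j|² = 0} into the hyperquadric M' = {(z',w') : Im w' + Σ_{j=1}^n (|z'_{2j−1}|² − |z'_{2j}|²) = 0}. -/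
noncomputable section

namespace Example05

/-- `[z] := z₁ + ⋯ + z_n`. -/
def brk (n : ℕ) (z : Fin n → ℂ) : ℂ := ∑ j, z j

/-- `F_{2j−1}(z,w) := z_j + [z]·z_j + (i/2)·w`. -/
def Fodd (n : ℕ) (z : Fin n → ℂ) (w : ℂ) (j : Fin n) : ℂ :=
  z j + brk n z * z j + Complex.I / 2 * w

/-- `F_{2j}(z,w) := z_j − [z]·z_j − (i/2)·w`. -/
def Feven (n : ℕ) (z : Fin n → ℂ) (w : ℂ) (j : Fin n) : ℂ :=
  z j - brk n z * z j - Complex.I / 2 * w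

/-- `G(z,w) := −2·[z]·w`. -/
def G (n : ℕ) (z : Fin n → ℂ) (w : ℂ) : ℂ := -2 * brk n z * w

end Example05

namespace Example05

theorem normSq_Fodd_sub_normSq_Feven (n : ℕ) (z : Fin n → ℂ) (w : ℂ) (j : Fin n) :
    Complex.normSq (Fodd n z w j) - Complex.normSq (Feven n z w j)
      = 4 * (brk n z).re * Complex.normSq (z j) - 2 * w.im * (z j).re + 2 * w.re * (z j).im := by
  simp only [Fodd, Feven, Complex.normSq_apply, Complex.add_re, Complex.add_im, Complex.sub_re,
    Complex.sub_im, Complex.mul_re, Complex.mul_im, Complex.div_ofNat_re, Complex.div_ofNat_im,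
    Complex.I_re, Complex.I_im]
  ring

theorem im_G_add_sum_normSq_sub_sum_normSq (n : ℕ) (z : Fin n → ℂ) (w : ℂ) :
    (G n z w).im + ∑ j, Complex.normSq (Fodd n z w j) - ∑ j, Complex.normSq (Feven n z w j)
      = 4 * (brk n z).re * (∑ j, Complex.normSq (z j) - w.im) := by
  have hG : (G n z w).im = -2 * ((brk n z).re * w.im + (brk n z).im * w.re) := by
    simp [G, Complex.mul_im, Complex.mul_re]
    ring
  have hre : (brk n z).re = ∑ j, (z j).re := Complex.re_sum _ _
  have him : (brk n z).im = ∑ j, (z j).im := Complex.im_sum _ _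
  rw [add_sub_assoc, ← Finset.sum_sub_distrib]
  simp_rw [normSq_Fodd_sub_normSq_Feven]
  rw [Finset.sum_add_distrib, Finset.sum_sub_distrib, ← Finset.mul_sum, ← Finset.mul_sum,
    ← Finset.mul_sum, ← hre, ← him, hG]
  ring

end Example05

open Example05 in
/-- The identity behind Example 1.2: for all `(z,w)`,
`Im G + Σ|F_{2j−1}|² − Σ|F_{2j}|² = i([z]+conj [z])(w − conj w − 2iΣ|z_j|²)`;
in particular `H = (F₁,…,F_{2n},G)` maps `{Im w = Σ|z_j|²}` into
`{Im w' + Σ(|z'_{2j−1}|² − |z'_{2j}|²) = 0}`. -/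
theorem statement_12 (n : ℕ) (hn : 1 ≤ n) (z : Fin n → ℂ) (w : ℂ) :
    (((G n z w).im : ℂ) + ∑ j, (Complex.normSq (Fodd n z w j) : ℂ)
        - ∑ j, (Complex.normSq (Feven n z w j) : ℂ)
      = Complex.I * (brk n z + (starRingEnd ℂ) (brk n z))
          * (w - (starRingEnd ℂ) w - 2 * Complex.I * ∑ j, (Complex.normSq (z j) : ℂ)))
    ∧ (w.im = ∑ j, Complex.normSq (z j) →
        (G n z w).im + ∑ j, Complex.normSq (Fodd n z w j)
          - ∑ j, Complex.normSq (Feven n z w j) = 0) := by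
  have key := im_G_add_sum_normSq_sub_sum_normSq n z w
  refine ⟨?_, fun h => by rw [key, h, sub_self, mul_zero]⟩
  rw [Complex.add_conj, Complex.sub_conj]
  have key' := congrArg (Complex.ofReal) key
  push_cast at key' ⊢
  rw [key']
  linear_combination (-4 * ((brk n z).re : ℂ) *
    ((w.im : ℂ) - ∑ j, (Complex.normSq (z j) : ℂ))) * Complex.I_sq
end
end

section
/- Define ρ : ℂ^n × ℂ → ℝ by ρ(z,w) = Im w − Σ_{j=1}^n |z_j|², ρ' : ℂ^{2n} × ℂ → ℝ by ρ'(z',w') = Im w' + Σ_{j=1}^n (|z'_{2j−1}|² − |z'_{2j}|²), and H = (F_1, …, F_{2n}, G) : ℂ^{n+1} → ℂ^{2n+1}. Then ρ' ∘ H = −4·Re([z])·ρ as functions on ℂ^{n+1}, and consequently at every point p = (z,w) ∈ ℂ^{n+1} with ρ(p) = 0 and Re([z]) = 0 the real Fréchet derivative of ρ' ∘ H at p is zero; hence H is not transversal at p (in particular at p = 0) to the hyperquadric M' = {ρ' = 0}. -/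
noncomputable section

namespace Example05

/-- `ρ(z,w) = Im w − Σ_{j=1}^n |z_j|²`. -/
def rhoSrc (n : ℕ) (p : (Fin n → ℂ) × ℂ) : ℝ :=
  p.2.im - ∑ j, Complex.normSq (p.1 j)

/-- `ρ'(z',w') = Im w' + Σ_{j=1}^n (|z'_{2j−1}|² − |z'_{2j}|²)`
(`z'_{2j−1}` has 0-based index `2j`, `z'_{2j}` has 0-based index `2j+1`). -/
def rhoTgt (n : ℕ) (p : (Fin (2*n) → ℂ) × ℂ) : ℝ :=
  p.2.im + ∑ j : Fin n,
    (Complex.normSq (p.1 ⟨2 * j.1, by have := j.2; omega⟩)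
      - Complex.normSq (p.1 ⟨2 * j.1 + 1, by have := j.2; omega⟩))

/-- The map `H = (F₁, F₂, …, F_{2n−1}, F_{2n}, G) : ℂ^{n+1} → ℂ^{2n+1}`. -/
def Hmap (n : ℕ) (p : (Fin n → ℂ) × ℂ) : (Fin (2*n) → ℂ) × ℂ :=
  (fun i => if i.1 % 2 = 0 then Fodd n p.1 p.2 ⟨i.1 / 2, by have := i.2; omega⟩
      else Feven n p.1 p.2 ⟨i.1 / 2, by have := i.2; omega⟩,
    G n p.1 p.2)

end Example05

namespace Example05

theorem normSq_add_sub_normSq_sub (a s w : ℂ) :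
    Complex.normSq (a + s * a + Complex.I / 2 * w) - Complex.normSq (a - s * a - Complex.I / 2 * w)
      = 4 * s.re * Complex.normSq a + 2 * (w.re * a.im - w.im * a.re) := by
  have h : Complex.I / 2 * w = ⟨-w.im / 2, w.re / 2⟩ := by
    apply Complex.ext <;> simp <;> ring
  rw [h]
  simp only [Complex.normSq_apply, Complex.add_re, Complex.add_im, Complex.sub_re, Complex.sub_im,
    Complex.mul_re, Complex.mul_im]
  ring

theorem rhoTgt_Hmap (n : ℕ) (p : (Fin n → ℂ) × ℂ) :
    rhoTgt n (Hmap n p) = -4 * (brk n p.1).re * rhoSrc n p := by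
  have hodd (j : Fin n) (hj : 2 * j.1 < 2 * n) :
      (Hmap n p).1 ⟨2 * j.1, hj⟩ = Fodd n p.1 p.2 j := by
    simp [Hmap]
  have heven (j : Fin n) (hj : 2 * j.1 + 1 < 2 * n) :
      (Hmap n p).1 ⟨2 * j.1 + 1, hj⟩ = Feven n p.1 p.2 j := by
    have h : (2 * j.1 + 1) / 2 = j.1 := by omega
    simp [Hmap, Nat.add_mod, h]
  have hG : (Hmap n p).2.im
      = -2 * ((brk n p.1).re * p.2.im + (brk n p.1).im * p.2.re) := by
    simp [Hmap, G]
    ring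
  have hre : ∑ j, (p.1 j).re = (brk n p.1).re := by simp [brk]
  have him : ∑ j, (p.1 j).im = (brk n p.1).im := by simp [brk]
  simp only [rhoTgt, hodd, heven, Fodd, Feven, normSq_add_sub_normSq_sub, hG, rhoSrc]
  rw [Finset.sum_add_distrib, ← Finset.mul_sum, ← Finset.mul_sum, Finset.sum_sub_distrib,
    ← Finset.mul_sum, ← Finset.mul_sum, hre, him]
  ring

theorem differentiable_rhoSrc (n : ℕ) : Differentiable ℝ (rhoSrc n) := by
  have him : Differentiable ℝ Complex.im := Complex.imCLM.differentiable
  have hre : Differentiable ℝ Complex.re := Complex.reCLM.differentiable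
  unfold rhoSrc
  simp only [Complex.normSq_apply]
  fun_prop

theorem differentiable_re_brk (n : ℕ) :
    Differentiable ℝ fun p : (Fin n → ℂ) × ℂ => (brk n p.1).re := by
  have hre : Differentiable ℝ Complex.re := Complex.reCLM.differentiable
  unfold brk
  fun_prop

end Example05

open Example05 in
/-- `ρ' ∘ H = −4·Re([z])·ρ`; hence at every point of `{ρ = 0} ∩ {Re [z] = 0}` the real
Fréchet derivative of `ρ' ∘ H` vanishes, so `H` is not transversal to `{ρ' = 0}` there
(in particular at `0`). -/
theorem statement_13 (n : ℕ) (hn : 1 ≤ n) :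
    (∀ p : (Fin n → ℂ) × ℂ, rhoTgt n (Hmap n p) = -4 * (brk n p.1).re * rhoSrc n p)
    ∧ ∀ p : (Fin n → ℂ) × ℂ, rhoSrc n p = 0 → (brk n p.1).re = 0 →
        fderiv ℝ (fun q => rhoTgt n (Hmap n q)) p = 0 := by
  refine ⟨rhoTgt_Hmap n, fun p hρ hre => ?_⟩
  simp only [rhoTgt_Hmap]
  rw [fderiv_fun_mul ((differentiable_re_brk n).const_mul (-4) p) (differentiable_rhoSrc n p)]
  simp [hρ, hre]
end
end

section
/- For every Z = (Z_1, …, Z_{n+1}) ∈ ℂ^{n+1} the identity |Z_1|⁴ + Σ_{j=2}^{n+1} |Z_1·Z_j|² − |Z_1|² = |Z_1|²·(Σ_{j=1}^{n+1} |Z_j|² − 1) holds. Consequently, for the polynomial map H : ℂ^{n+1} → ℂ^{n+3} given by H(Z) = (Z_1², Z_1·Z_2, …, Z_1·Z_{n+1}, Z_1, 0), with ρ'(z', w') := Im w' − (Σ_{j=1}^{n+1} |z'_j|² − |z'_{n+2}|²), one has (ρ' ∘ H)(Z) = −|Z_1|²·(Σ_{j=1}^{n+1} |Z_j|² − 1);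 hence H maps the unit sphere {Z ∈ ℂ^{n+1} : Σ_{j=1}^{n+1} |Z_j|² = 1} into the hyperquadric {(z',w') ∈ ℂ^{n+2} × ℂ : ρ'(z',w') = 0}, and the real Fréchet derivative of ρ' ∘ H vanishes at every point with Z_1 = 0, so H fails to be transversal to the hyperquadric along the intersection of the sphere with {Z_1 = 0}. -/
noncomputable section

namespace Example13

/-- `ρ'(z',w') := Im w' − (Σ_{j=1}^{n+1} |z'_j|² − |z'_{n+2}|²)` on `ℂ^{n+2} × ℂ`. -/
def rhoTgt (n : ℕ) (p : (Fin (n+2) → ℂ) × ℂ) : ℝ :=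
  p.2.im - ((∑ j : Fin (n+1), Complex.normSq (p.1 j.castSucc))
    - Complex.normSq (p.1 (Fin.last (n+1))))

/-- `H(Z) = (Z₁², Z₁Z₂, …, Z₁Z_{n+1}, Z₁, 0) : ℂ^{n+1} → ℂ^{n+3} = ℂ^{n+2} × ℂ`. -/
def Hmap (n : ℕ) (Z : Fin (n+1) → ℂ) : (Fin (n+2) → ℂ) × ℂ :=
  (fun i => Fin.lastCases (Z 0) (fun j => Z 0 * Z j) i, 0)

end Example13

namespace Example13

theorem rhoTgt_Hmap (n : ℕ) (Z : Fin (n+1) → ℂ) :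
    rhoTgt n (Hmap n Z) = -(Complex.normSq (Z 0)) * ((∑ j, Complex.normSq (Z j)) - 1) := by
  simp only [rhoTgt, Hmap, Fin.lastCases_castSucc, Fin.lastCases_last, map_mul,
    ← Finset.mul_sum, Complex.zero_im]
  ring

/-- The real Fréchet derivative of `ρ' ∘ H` exists and vanishes wherever `Z₁ = 0`. -/
theorem hasFDerivAt_rhoTgt_Hmap (n : ℕ) (Z : Fin (n+1) → ℂ) (hZ : Z 0 = 0) :
    HasFDerivAt (fun W => rhoTgt n (Hmap n W)) (0 : (Fin (n+1) → ℂ) →L[ℝ] ℝ) Z := by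
  have hcoord (j : Fin (n+1)) : HasFDerivAt (fun W : Fin (n+1) → ℂ => Complex.normSq (W j))
      (2 • (innerSL ℝ (Z j)).comp (ContinuousLinearMap.proj j)) Z := by
    simpa only [Complex.normSq_eq_norm_sq] using
      (hasFDerivAt_apply (𝕜 := ℝ) j Z).norm_sq
  have h := (hcoord 0).neg.mul
    ((HasFDerivAt.fun_sum fun j (_ : j ∈ Finset.univ) => hcoord j).sub_const 1)
  simp only [rhoTgt_Hmap]
  refine h.congr_fderiv ?_
  simp [hZ]

end Example13

open Example13 in
/-- Example 1.3: `|Z₁|⁴ + Σ_{j=2}^{n+1}|Z₁Z_j|² − |Z₁|² = |Z₁|²(Σ_{j=1}^{n+1}|Z_j|² − 1)`;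
hence `ρ' ∘ H = −|Z₁|²(Σ|Z_j|² − 1)`, `H` maps the unit sphere into `{ρ' = 0}`, and the
real Fréchet derivative of `ρ' ∘ H` vanishes wherever `Z₁ = 0`, so `H` fails to be
transversal along the intersection of the sphere with `{Z₁ = 0}`. -/
theorem statement_14 (n : ℕ) (hn : 1 ≤ n) :
    (∀ Z : Fin (n+1) → ℂ,
      Complex.normSq (Z 0) ^ 2 + (∑ j : Fin n, Complex.normSq (Z 0 * Z j.succ))
          - Complex.normSq (Z 0)
        = Complex.normSq (Z 0) * ((∑ j, Complex.normSq (Z j)) - 1))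
    ∧ (∀ Z : Fin (n+1) → ℂ,
        rhoTgt n (Hmap n Z) = -(Complex.normSq (Z 0)) * ((∑ j, Complex.normSq (Z j)) - 1))
    ∧ (∀ Z : Fin (n+1) → ℂ, (∑ j, Complex.normSq (Z j)) = 1 → rhoTgt n (Hmap n Z) = 0)
    ∧ (∀ Z : Fin (n+1) → ℂ, Z 0 = 0 → fderiv ℝ (fun W => rhoTgt n (Hmap n W)) Z = 0) := by
  refine ⟨fun Z => ?_, rhoTgt_Hmap n, fun Z hZ => ?_,
    fun Z hZ => (hasFDerivAt_rhoTgt_Hmap n Z hZ).fderiv⟩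
  · simp only [Fin.sum_univ_succ, map_mul, ← Finset.mul_sum]
    ring
  · rw [rhoTgt_Hmap, hZ, sub_self, mul_zero]
end
end
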